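/- The wheel graph W_4 (the cycle C_4 together with a hub adjacent to all four rim vertices) satisfies tndi(W_4) = 5 = Δ + 1, where Δ = 4 is its maximum degree. -/

import Mathlib

open Finset SimpleGraph

/-- A neighbor-sum-distinguishing proper total `k`-coloring of `G`:
vertex colors `cv` and edge colors `ce` taken from `{1, …, k}`, proper on
vertices, edges, and incidences, and distinguishing adjacent vertices by the
total sum of colors at each vertex. -/
def IsProperTotalColoring {V : Type*} [Fintype V] (G : SimpleGraph V) (k : ℕ)
    (cv : V → ℕ) (ce : Sym2 V → ℕ) : Prop :=
  (∀ v, cv v ∈ Finset.Icc 1 k) ∧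
  (∀ u v, G.Adj u v → ce s(u, v) ∈ Finset.Icc 1 k) ∧
  (∀ u v, G.Adj u v → cv u ≠ cv v) ∧
  (∀ u v w, G.Adj u v → G.Adj u w → v ≠ w → ce s(u, v) ≠ ce s(u, w)) ∧
  (∀ u v, G.Adj u v → ce s(u, v) ≠ cv u ∧ ce s(u, v) ≠ cv v)

open Classical in
/-- The total color-sum at a vertex: the color of `v` plus the colors of all
edges incident with `v`. -/
noncomputable def totalSum {V : Type*} [Fintype V] (G : SimpleGraph V)
    (cv : V → ℕ) (ce : Sym2 V → ℕ) (v : V) : ℕ :=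
  cv v + ∑ w ∈ Finset.univ.filter (fun w => G.Adj v w), ce s(v, w)

/-- A neighbor-sum-distinguishing proper total `k`-coloring. -/
def IsNSDColoring {V : Type*} [Fintype V] (G : SimpleGraph V) (k : ℕ)
    (cv : V → ℕ) (ce : Sym2 V → ℕ) : Prop :=
  IsProperTotalColoring G k cv ce ∧
  ∀ u v, G.Adj u v → totalSum G cv ce u ≠ totalSum G cv ce v

/-- `tndi G` is the least `k` such that `G` admits a neighbor-sum-distinguishing
proper total `k`-coloring. -/
noncomputable def tndi {V : Type*} [Fintype V] (G : SimpleGraph V) : ℕ :=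
  sInf {k | ∃ cv ce, IsNSDColoring G k cv ce}

/-- The maximum degree of a finite simple graph. -/
noncomputable def maxDeg {V : Type*} [Fintype V] (G : SimpleGraph V) : ℕ :=
  @SimpleGraph.maxDegree V G _ (Classical.decRel _)

/-- The star `S_n = K_{1,n}` with center `0` and `n` leaves. -/
def starGraph (n : ℕ) : SimpleGraph (Fin (n + 1)) :=
  SimpleGraph.fromRel fun i _ => i = 0

/-- The wheel `W_m`: hub `0` joined to every vertex of the cycle on `1, …, m`. -/
def wheelGraph (m : ℕ) : SimpleGraph (Fin (m + 1)) :=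
  SimpleGraph.fromRel fun i j =>
    i = 0 ∨ (j.val = i.val + 1 ∧ 2 ≤ j.val) ∨ (i.val = m ∧ j.val = 1)

/-- A proper total coloring uses more colors than the maximum degree: a vertex of maximum degree
and the edges at it all receive distinct colors. -/
theorem IsProperTotalColoring.maxDeg_lt {V : Type*} [Fintype V] [Nonempty V]
    {G : SimpleGraph V} {k : ℕ} {cv : V → ℕ} {ce : Sym2 V → ℕ}
    (h : IsProperTotalColoring G k cv ce) : maxDeg G < k := by
  classical
  let : DecidableRel G.Adj := Classical.decRel _
  obtain ⟨hv, he, -, hee, hve⟩ := h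
  obtain ⟨v, hmax⟩ := G.exists_maximal_degree_vertex
  have hinj : Set.InjOn (fun w => ce s(v, w)) (G.neighborFinset v) := by
    intro a ha b hb hab
    by_contra hne
    exact hee v a b (by simpa using ha) (by simpa using hb) hne hab
  have hnot : cv v ∉ (G.neighborFinset v).image (fun w => ce s(v, w)) := by
    simp only [Finset.mem_image, mem_neighborFinset, not_exists, not_and]
    exact fun w hw => (hve v w hw).1
  have hsub : insert (cv v) ((G.neighborFinset v).image fun w => ce s(v, w)) ⊆
      Finset.Icc 1 k := by
    refine Finset.insert_subset (hv v) (Finset.image_subset_iff.2 fun w hw => he v w ?_)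
    simpa using hw
  have hcard := Finset.card_le_card hsub
  rw [Finset.card_insert_of_notMem hnot, Finset.card_image_of_injOn hinj,
    card_neighborFinset_eq_degree, Nat.card_Icc] at hcard
  change G.maxDegree < k
  omega

instance (m : ℕ) : DecidableRel (wheelGraph m).Adj := fun i j =>
  inferInstanceAs (Decidable (i ≠ j ∧ (_ ∨ _)))

theorem maxDeg_wheelGraph_four : maxDeg (wheelGraph 4) = 4 := by
  have h : (wheelGraph 4).maxDegree = 4 := by decide +kernel
  unfold maxDeg
  convert h

/-- Vertex colors of a neighbor-sum-distinguishing total 5-coloring of `W_4`. -/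
def wheelFourVertexColor : Fin 5 → ℕ := ![5, 1, 2, 1, 2]

/-- Edge colors of a neighbor-sum-distinguishing total 5-coloring of `W_4`; non-edges get `0`. -/
def wheelFourEdgeColor : Sym2 (Fin 5) → ℕ :=
  Sym2.lift ⟨fun i j =>
    (!![0, 2, 1, 3, 4; 2, 0, 5, 0, 3; 1, 5, 0, 4, 0; 3, 0, 4, 0, 5; 4, 3, 0, 5, 0] :
      Matrix (Fin 5) (Fin 5) ℕ) i j,
    by decide⟩

theorem totalSum_wheelFour (v : Fin 5) :
    totalSum (wheelGraph 4) wheelFourVertexColor wheelFourEdgeColor v =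
      ![15, 11, 12, 13, 14] v := by
  have h : ∀ v : Fin 5, wheelFourVertexColor v +
      ∑ w ∈ Finset.univ.filter (fun w => (wheelGraph 4).Adj v w), wheelFourEdgeColor s(v, w) =
      ![15, 11, 12, 13, 14] v := by decide +kernel
  unfold totalSum
  convert h v

theorem isNSDColoring_wheelFour :
    IsNSDColoring (wheelGraph 4) 5 wheelFourVertexColor wheelFourEdgeColor := by
  refine ⟨⟨?_, ?_, ?_, ?_, ?_⟩, ?_⟩
  iterate 5 decide +kernel
  simp only [totalSum_wheelFour]
  decide +kernel

theorem stmt_17 :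
    maxDeg (wheelGraph 4) = 4 ∧ tndi (wheelGraph 4) = 5 := by
  refine ⟨maxDeg_wheelGraph_four, le_antisymm (Nat.sInf_le ⟨_, _, isNSDColoring_wheelFour⟩) ?_⟩
  refine le_csInf ⟨5, _, _, isNSDColoring_wheelFour⟩ ?_
  rintro k ⟨cv, ce, h⟩
  have hlt := h.1.maxDeg_lt
  rw [maxDeg_wheelGraph_four] at hlt
  exact hlt
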